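/- arXiv:2407.04835 — 3 statements merged into one kernel-verified Lean document; each statement's English description precedes it below -/
import Mathlib

section
/- Let $q > p > 2$ be finite real numbers. Then there exists a constant $C = C(p,q) > 0$ such that for every real-valued random variable $X$ on a probability space with $\mathbb{E}|X|^2 = 1$ and $\mathbb{E}|X|^q < \infty$, one has $\mathbb{E}|X| \leq 1 - C \cdot (\mathbb{E}|X|^p - 1)^{(q-2)/(q-p)} / (\mathbb{E}|X|^q - 1)^{(p-2)/(q-p)}$. -/
open MeasureTheory

lemma scs_mono (F F' : ℝ → ℝ) (hF : ∀ x, HasDerivAt F (F' x) x) (h1 : F 1 = 0)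
    (hpos : ∀ x, 1 ≤ x → 0 ≤ F' x) (hneg : ∀ x, 0 < x → x ≤ 1 → F' x ≤ 0)
    (y : ℝ) (hy : 0 ≤ y) : 0 ≤ F y := by
  have hc : Continuous F := continuous_iff_continuousAt.2 fun x => (hF x).continuousAt
  have hd : Differentiable ℝ F := fun x => (hF x).differentiableAt
  rcases le_total 1 y with h | h
  · have := monotoneOn_of_deriv_nonneg (convex_Ici (1:ℝ)) hc.continuousOn hd.differentiableOn
      (by
        intro x hx
        rw [interior_Ici] at hx
        rw [(hF x).deriv]
        exact hpos x (le_of_lt hx))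
    have := this (Set.mem_Ici.2 le_rfl) (Set.mem_Ici.2 h) h
    linarith
  · have := antitoneOn_of_deriv_nonpos (convex_Icc (0:ℝ) 1) hc.continuousOn hd.differentiableOn
      (by
        intro x hx
        rw [interior_Icc] at hx
        rw [(hF x).deriv]
        exact hneg x hx.1 hx.2.le)
    have := this ⟨hy, h⟩ ⟨zero_le_one, le_rfl⟩ h
    linarith

/-- second-order remainder is nonnegative -/
lemma scs_nonneg (r : ℝ) (hr : 2 < r) (y : ℝ) (hy : 0 ≤ y) :
    0 ≤ y ^ r - 1 - r / 2 * (y ^ 2 - 1) := by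
  have h := one_add_mul_self_le_rpow_one_add (s := y ^ 2 - 1) (by nlinarith [sq_nonneg y])
    (p := r / 2) (by linarith)
  have e : (1 + (y ^ 2 - 1)) ^ (r / 2) = y ^ r := by
    rw [show 1 + (y ^ 2 - 1) = y ^ (2:ℝ) by rw [Real.rpow_two]; ring, ← Real.rpow_mul hy]
    congr 1; ring
  rw [e] at h
  linarith

lemma scs_point (p q : ℝ) (hp : 2 < p) (hpq : p < q) (l : ℝ) (hl : 0 < l) (y : ℝ) (hy : 0 ≤ y) :
    y ^ p - 1 - p / 2 * (y ^ 2 - 1) ≤ p * (p - 1) / 2 * l ^ (p - 2) * (y - 1) ^ 2 +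
      p / q * l ^ (p - q) * (y ^ q - 1 - q / 2 * (y ^ 2 - 1)) := by
  have hq0 : q ≠ 0 := by linarith
  have key := scs_mono (fun y => p * (p - 1) / 2 * l ^ (p - 2) * (y - 1) ^ 2 +
      p / q * l ^ (p - q) * (y ^ q - 1 - q / 2 * (y ^ 2 - 1)) -
      (y ^ p - 1 - p / 2 * (y ^ 2 - 1)))
    (fun y => p * ((p - 1) * l ^ (p - 2) * (y - 1) + l ^ (p - q) * (y ^ (q - 1) - y)
      - (y ^ (p - 1) - y))) ?_ ?_ ?_ ?_ y hy
  · linarith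
  · intro x
    have h2 : HasDerivAt (fun y : ℝ => y ^ 2 - 1) (2 * x) x := by
      simpa using (hasDerivAt_pow 2 x).sub_const 1
    have h3 : HasDerivAt (fun y : ℝ => (y - 1) ^ 2) (2 * (x - 1)) x := by
      have := ((hasDerivAt_id' x).sub_const (1:ℝ)).fun_pow 2
      exact this.congr_deriv (by simp)
    have hP : HasDerivAt (fun y : ℝ => y ^ p) (p * x ^ (p - 1)) x :=
      Real.hasDerivAt_rpow_const (Or.inr (by linarith))
    have hQ : HasDerivAt (fun y : ℝ => y ^ q) (q * x ^ (q - 1)) x :=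
      Real.hasDerivAt_rpow_const (Or.inr (by linarith))
    have := ((h3.const_mul (p * (p - 1) / 2 * l ^ (p - 2))).add
      (((hQ.sub_const 1).sub (h2.const_mul (q / 2))).const_mul (p / q * l ^ (p - q)))).sub
      ((hP.sub_const 1).sub (h2.const_mul (p / 2)))
    refine this.congr_deriv ?_
    field_simp
  · simp
  · intro x hx
    have hx0 : 0 < x := by linarith
    have hq1 : x ^ (q - 1) = x ^ (q - 2) * x := by
      rw [← Real.rpow_add_one hx0.ne']; congr 1; ring
    have hp1 : x ^ (p - 1) = x ^ (p - 2) * x := by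
      rw [← Real.rpow_add_one hx0.ne']; congr 1; ring
    have hlp : 0 < l ^ (p - 2) := Real.rpow_pos_of_pos hl _
    have hlq : 0 < l ^ (p - q) := Real.rpow_pos_of_pos hl _
    have hxp : 1 ≤ x ^ (p - 2) := Real.one_le_rpow hx (by linarith)
    have hxq : 1 ≤ x ^ (q - 2) := Real.one_le_rpow hx (by linarith)
    apply mul_nonneg (by linarith)
    have t1 : 0 ≤ (p - 1) * l ^ (p - 2) * (x - 1) :=
      mul_nonneg (mul_nonneg (by linarith) hlp.le) (by linarith)
    have t2 : 0 ≤ l ^ (p - q) * (x ^ (q - 1) - x) := by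
      apply mul_nonneg hlq.le
      rw [hq1]; nlinarith
    rcases le_total x l with h | h
    · have hb := one_add_mul_self_le_rpow_one_add (s := x⁻¹ - 1)
        (by have := inv_pos.2 hx0; linarith) (p := p - 1) (by linarith)
      rw [show 1 + (x⁻¹ - 1) = x⁻¹ by ring, Real.inv_rpow hx0.le] at hb
      have hX : 0 < x ^ (p - 1) := Real.rpow_pos_of_pos hx0 _
      have h4 := mul_le_mul_of_nonneg_left hb hX.le
      rw [mul_inv_cancel₀ hX.ne'] at h4
      have h5 : x ^ (p - 1) * (1 + (p - 1) * (x⁻¹ - 1))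
          = x ^ (p - 1) - (p - 1) * (x ^ (p - 2) * (x - 1)) := by
        rw [hp1]; field_simp; ring
      rw [h5] at h4
      have h6 : x ^ (p - 2) ≤ l ^ (p - 2) := Real.rpow_le_rpow hx0.le h (by linarith)
      have h7 : (p - 1) * (x ^ (p - 2) * (x - 1)) ≤ (p - 1) * l ^ (p - 2) * (x - 1) := by
        rw [← mul_assoc]
        apply mul_le_mul_of_nonneg_right _ (by linarith)
        exact mul_le_mul_of_nonneg_left h6 (by linarith)
      linarith
    · have h6 : x ^ (p - q) ≤ l ^ (p - q) :=
        Real.rpow_le_rpow_of_nonpos hl h (by linarith)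
      have h7 : x ^ (p - q) * x ^ (q - 2) = x ^ (p - 2) := by
        rw [← Real.rpow_add hx0]; congr 1; ring
      have h8 : x ^ (p - q) ≤ 1 := Real.rpow_le_one_of_one_le_of_nonpos hx (by linarith)
      have h9 : x ^ (p - q) * (x ^ (q - 2) - 1) ≤ l ^ (p - q) * (x ^ (q - 2) - 1) :=
        mul_le_mul_of_nonneg_right h6 (by linarith)
      have h10 : x ^ (p - 2) - 1 ≤ l ^ (p - q) * (x ^ (q - 2) - 1) := by
        nlinarith
      have h11 := mul_le_mul_of_nonneg_right h10 hx0.le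
      rw [hp1, hq1]
      nlinarith
  · intro x hx0 hx
    have hq1 : x ^ (q - 1) = x ^ (q - 2) * x := by
      rw [← Real.rpow_add_one hx0.ne']; congr 1; ring
    have hp1 : x ^ (p - 1) = x ^ (p - 2) * x := by
      rw [← Real.rpow_add_one hx0.ne']; congr 1; ring
    have hlp : 0 < l ^ (p - 2) := Real.rpow_pos_of_pos hl _
    have hlq : 0 < l ^ (p - q) := Real.rpow_pos_of_pos hl _
    have hxq : x ^ (q - 2) ≤ 1 := Real.rpow_le_one hx0.le hx (by linarith)
    have hqp : x ^ (q - 2) ≤ x ^ (p - 2) :=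
      Real.rpow_le_rpow_of_exponent_ge hx0 hx (by linarith)
    apply mul_nonpos_of_nonneg_of_nonpos (by linarith)
    have t1 : 0 ≤ (p - 1) * l ^ (p - 2) * (1 - x) :=
      mul_nonneg (mul_nonneg (by linarith) hlp.le) (by linarith)
    have t2 : 0 ≤ l ^ (p - q) * (x - x ^ (q - 1)) := by
      apply mul_nonneg hlq.le
      rw [hq1]; nlinarith
    rcases le_total 1 l with h | h
    · have hb := one_add_mul_self_le_rpow_one_add (s := x - 1)
        (by linarith) (p := p - 1) (by linarith)
      rw [show 1 + (x - 1) = x by ring] at hb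
      have h6 : 1 ≤ l ^ (p - 2) := Real.one_le_rpow h (by linarith)
      have h7 : (p - 1) * (1 - x) * 1 ≤ (p - 1) * (1 - x) * l ^ (p - 2) :=
        mul_le_mul_of_nonneg_left h6 (mul_nonneg (by linarith) (by linarith))
      nlinarith
    · have h6 : 1 ≤ l ^ (p - q) :=
        Real.one_le_rpow_of_pos_of_le_one_of_nonpos hl h (by linarith)
      have h9 : 1 * (x - x ^ (q - 1)) ≤ l ^ (p - q) * (x - x ^ (q - 1)) := by
        apply mul_le_mul_of_nonneg_right h6
        rw [hq1]; nlinarith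
      have : x ^ (q - 1) ≤ x ^ (p - 1) := by
        rw [hp1, hq1]; exact mul_le_mul_of_nonneg_right hqp hx0.le
      nlinarith

lemma scs_int {Ω : Type} [MeasurableSpace Ω] (μ : Measure Ω) [IsProbabilityMeasure μ]
    (X : Ω → ℝ) (hX : Measurable X) (r q : ℝ) (hr : 0 ≤ r) (hrq : r ≤ q)
    (h : Integrable (fun ω => |X ω| ^ q) μ) : Integrable (fun ω => |X ω| ^ r) μ := by
  refine ((integrable_const (1:ℝ)).add h).mono' (by
    have : Measurable fun ω => |X ω| ^ r := by fun_prop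
    exact this.aestronglyMeasurable) (Filter.Eventually.of_forall fun ω => ?_)
  have h0 : 0 ≤ |X ω| := abs_nonneg _
  rw [Real.norm_of_nonneg (Real.rpow_nonneg h0 _)]
  simp only [Pi.add_apply]
  have hq := Real.rpow_nonneg h0 q
  rcases le_total (|X ω|) 1 with h1 | h1
  · have := Real.rpow_le_one h0 h1 hr
    linarith
  · have := Real.rpow_le_rpow_of_exponent_le h1 hrq
    linarith

lemma scs_final (p q : ℝ) (hp : 2 < p) (hpq : p < q) (K1 K2 P Q D : ℝ) (h1 : 0 < K1) (h2 : 0 < K2)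
    (hP : 0 ≤ P) (hQ : 0 < Q) (hD : 0 < D)
    (h : ∀ l : ℝ, 0 < l → P ≤ K1 * l ^ (p - 2) * D + K2 * l ^ (p - q) * Q) :
    1 / (K1 + K2) ^ ((q - 2) / (q - p)) * P ^ ((q - 2) / (q - p)) / Q ^ ((p - 2) / (q - p)) ≤ D := by
  have hT : 0 < Q / D := div_pos hQ hD
  have hq2 : q - 2 ≠ 0 := by linarith
  have hqp : q - p ≠ 0 := by linarith
  have ha : 0 ≤ (q - 2) / (q - p) := div_nonneg (by linarith) (by linarith)
  have hl := h ((Q / D) ^ (1 / (q - 2))) (Real.rpow_pos_of_pos hT _)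
  rw [← Real.rpow_mul hT.le, ← Real.rpow_mul hT.le,
    show 1 / (q - 2) * (p - q) = 1 / (q - 2) * (p - 2) - 1 by field_simp; ring,
    Real.rpow_sub_one hT.ne'] at hl
  set M := (Q / D) ^ (1 / (q - 2) * (p - 2)) with hM
  have hM0 : 0 < M := Real.rpow_pos_of_pos hT _
  have e : K1 * M * D + K2 * (M / (Q / D)) * Q = (K1 + K2) * (M * D) := by
    field_simp
  rw [e] at hl
  have hK : 0 < K1 + K2 := by linarith
  have h3 := Real.rpow_le_rpow hP hl ha
  rw [Real.mul_rpow hK.le (by positivity), Real.mul_rpow hM0.le hD.le, hM,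
    ← Real.rpow_mul hT.le,
    show 1 / (q - 2) * (p - 2) * ((q - 2) / (q - p)) = (p - 2) / (q - p) by field_simp,
    Real.div_rpow hQ.le hD.le] at h3
  have e2 : D ^ ((q - 2) / (q - p)) = D ^ ((p - 2) / (q - p)) * D := by
    rw [← Real.rpow_add_one hD.ne']; congr 1; field_simp; ring
  rw [e2] at h3
  have hDb : 0 < D ^ ((p - 2) / (q - p)) := Real.rpow_pos_of_pos hD _
  have hQb : 0 < Q ^ ((p - 2) / (q - p)) := Real.rpow_pos_of_pos hQ _
  have hKa : 0 < (K1 + K2) ^ ((q - 2) / (q - p)) := Real.rpow_pos_of_pos hK _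
  rw [div_le_iff₀ hQb, one_div, inv_mul_le_iff₀ hKa]
  refine h3.trans (le_of_eq ?_)
  field_simp

/-- **Theorem 1 (main theorem).** Let `q > p > 2` be finite real numbers. Then there exists a
constant `C = C(p,q) > 0` such that for every real-valued random variable `X` on a probability
space with `E|X|^2 = 1` and `E|X|^q < ∞`, one has
`E|X| ≤ 1 - C * (E|X|^p - 1)^((q-2)/(q-p)) / (E|X|^q - 1)^((p-2)/(q-p))`. -/
theorem sharpened_cauchy_schwarz (p q : ℝ) (hp : 2 < p) (hpq : p < q) :
    ∃ C : ℝ, 0 < C ∧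
      ∀ (Ω : Type) (_ : MeasurableSpace Ω) (μ : Measure Ω), IsProbabilityMeasure μ →
        ∀ X : Ω → ℝ, Measurable X →
          (∫ ω, |X ω| ^ (2 : ℝ) ∂μ) = 1 →
          Integrable (fun ω => |X ω| ^ q) μ →
          (∫ ω, |X ω| ∂μ) ≤ 1 - C *
            ((∫ ω, |X ω| ^ p ∂μ) - 1) ^ ((q - 2) / (q - p)) /
              ((∫ ω, |X ω| ^ q ∂μ) - 1) ^ ((p - 2) / (q - p)) := by
  have hK1 : 0 < p * (p - 1) / 2 := div_pos (mul_pos (by linarith) (by linarith)) two_pos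
  have hK2 : 0 < p / q := div_pos (by linarith) (by linarith)
  have hKa : 0 < (p * (p - 1) / 2 + p / q) ^ ((q - 2) / (q - p)) :=
    Real.rpow_pos_of_pos (by linarith) _
  refine ⟨1 / (p * (p - 1) / 2 + p / q) ^ ((q - 2) / (q - p)) / 2, by positivity, ?_⟩
  intro Ω _ μ hμ X hX h2 hq
  have i1 : Integrable (fun ω => |X ω|) μ := by
    simpa using scs_int μ X hX 1 q (by norm_num) (by linarith) hq
  have i2 : Integrable (fun ω => |X ω| ^ 2) μ := by
    simpa only [Real.rpow_two] using scs_int μ X hX 2 q (by norm_num) (by linarith) hq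
  have ip := scs_int μ X hX p q (by linarith) (by linarith) hq
  simp only [Real.rpow_two] at h2
  have c1 : Integrable (fun _ : Ω => (1:ℝ)) μ := integrable_const _
  have j2 : Integrable (fun ω => |X ω| ^ 2 - 1) μ := i2.sub c1
  have j1 : Integrable (fun ω => |X ω| - 1) μ := i1.sub c1
  have eG : ∀ r : ℝ, Integrable (fun ω => |X ω| ^ r) μ →
      Integrable (fun ω => |X ω| ^ r - 1 - r / 2 * (|X ω| ^ 2 - 1)) μ ∧
      ∫ ω, (|X ω| ^ r - 1 - r / 2 * (|X ω| ^ 2 - 1)) ∂μ = (∫ ω, |X ω| ^ r ∂μ) - 1 := by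
    intro r hr
    have jr : Integrable (fun ω => |X ω| ^ r - 1) μ := hr.sub c1
    refine ⟨(hr.sub c1).sub ((i2.sub c1).const_mul _), ?_⟩
    rw [integral_sub jr (j2.const_mul _), integral_sub hr c1,
      integral_const_mul, integral_sub i2 c1, h2]
    simp
  have efun : (fun ω => (|X ω| - 1) ^ 2) = fun ω => (|X ω| ^ 2 - 1) - 2 * (|X ω| - 1) := by
    ext ω; ring
  have iD : Integrable (fun ω => (|X ω| - 1) ^ 2) μ := by
    rw [efun]; exact (i2.sub c1).sub ((i1.sub c1).const_mul _)
  have eD : ∫ ω, (|X ω| - 1) ^ 2 ∂μ = 2 * (1 - ∫ ω, |X ω| ∂μ) := by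
    rw [efun, integral_sub j2 (j1.const_mul _), integral_const_mul,
      integral_sub i2 c1, integral_sub i1 c1, h2]
    simp; ring
  have hD0 : 0 ≤ ∫ ω, (|X ω| - 1) ^ 2 ∂μ := integral_nonneg fun ω => sq_nonneg _
  obtain ⟨iGp, eGp⟩ := eG p ip
  obtain ⟨iGq, eGq⟩ := eG q hq
  have hP0 : 0 ≤ (∫ ω, |X ω| ^ p ∂μ) - 1 := by
    rw [← eGp]; exact integral_nonneg fun ω => scs_nonneg p hp _ (abs_nonneg _)
  have hQ0 : 0 ≤ (∫ ω, |X ω| ^ q ∂μ) - 1 := by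
    rw [← eGq]; exact integral_nonneg fun ω => scs_nonneg q (by linarith) _ (abs_nonneg _)
  rcases hQ0.eq_or_lt with hQ | hQ
  · rw [← hQ, Real.zero_rpow (div_pos (by linarith) (by linarith)).ne', div_zero]
    linarith
  have hD : 0 < ∫ ω, (|X ω| - 1) ^ 2 ∂μ := by
    refine lt_of_le_of_ne hD0 fun h => ?_
    have hz := (integral_eq_zero_iff_of_nonneg (fun ω => sq_nonneg _) iD).1 h.symm
    have : ∫ ω, |X ω| ^ q ∂μ = ∫ ω, (1:ℝ) ∂μ := by
      apply integral_congr_ae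
      filter_upwards [hz] with ω hω
      have : |X ω| - 1 = 0 := by simpa using hω
      rw [show |X ω| = 1 by linarith, Real.one_rpow]
    rw [this] at hQ
    simp at hQ
  have main := scs_final p q hp hpq _ _ _ _ _ hK1 hK2 hP0 hQ hD (by
    intro l hl
    rw [← eGp, ← eGq, ← integral_const_mul, ← integral_const_mul,
      ← integral_add (iD.const_mul _) (iGq.const_mul _)]
    exact integral_mono iGp ((iD.const_mul _).add (iGq.const_mul _))
      fun ω => scs_point p q hp hpq l hl _ (abs_nonneg _))
  rw [eD] at main
  have : ∀ a b c : ℝ, a / 2 * b / c = (a * b / c) / 2 := by intro a b c; ring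
  rw [this]
  linarith
end

section
/- For every $n \geq 1$ and every function $f : \{-1,1\}^n \to \mathbb{R}$, one has $\mathbb{E}|f(x) - \mathbb{E}f(x)| \leq (\tfrac{\pi}{2} - \delta) \, \mathbb{E}|\nabla f|(x)$ with $\delta = 10^{-4}$, where $x$ is uniformly distributed on $\{-1,1\}^n$. -/
open Real

/-- The discrete partial derivative `Dⱼf(x) = (f(x) - f(Sⱼ(x)))/2` of a function on the
hypercube (coordinates encoded by `Bool`, flipping a coordinate corresponds to the sign
flip `Sⱼ`). -/
noncomputable def discDeriv {n : ℕ} (f : (Fin n → Bool) → ℝ) (j : Fin n)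
    (x : Fin n → Bool) : ℝ :=
  (f x - f (Function.update x j (!(x j)))) / 2

/-- The gradient modulus `|∇f|(x) = (∑ⱼ |Dⱼf(x)|²)^{1/2}`. -/
noncomputable def discGradNorm {n : ℕ} (f : (Fin n → Bool) → ℝ) (x : Fin n → Bool) : ℝ :=
  Real.sqrt (∑ j, (discDeriv f j x) ^ 2)

/-- Expectation with respect to the uniform probability measure on the hypercube
`{-1,1}ⁿ` (encoded as `Fin n → Bool`). -/
noncomputable def cubeExp {n : ℕ} (g : (Fin n → Bool) → ℝ) : ℝ :=
  (∑ x : Fin n → Bool, g x) / 2 ^ n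

/-- Weighted expectation over the cube for a product weight. -/
noncomputable def pEW (w : Bool → ℝ) {n : ℕ} (F : (Fin n → Bool) → ℝ) : ℝ :=
  ∑ ξ : Fin n → Bool, (∏ i, w (ξ i)) * F ξ

/-- Linear form in the variables `d (ξ i)`. -/
noncomputable def linF (d : Bool → ℝ) {n : ℕ} (a : Fin n → ℝ) (ξ : Fin n → Bool) : ℝ :=
  ∑ i, a i * d (ξ i)

lemma pEW_succ (w : Bool → ℝ) {n : ℕ} (F : (Fin (n+1) → Bool) → ℝ) :
    pEW w F = pEW w (fun ξ : Fin n → Bool =>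
      w false * F (Fin.cons false ξ) + w true * F (Fin.cons true ξ)) := by
  unfold pEW
  rw [← (Fin.consEquiv (fun _ : Fin (n+1) => Bool)).sum_comp, Fintype.sum_prod_type]
  simp only [Fintype.sum_bool, Fin.consEquiv, Equiv.coe_fn_mk, Fin.prod_univ_succ, Fin.cons_zero,
    Fin.cons_succ]
  rw [← Finset.sum_add_distrib]
  refine Finset.sum_congr rfl fun ξ _ => ?_
  ring

lemma pEW_add (w : Bool → ℝ) {n : ℕ} (F G : (Fin n → Bool) → ℝ) :
    pEW w (fun ξ => F ξ + G ξ) = pEW w F + pEW w G := by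
  simp [pEW, mul_add, Finset.sum_add_distrib]

lemma pEW_mul (w : Bool → ℝ) {n : ℕ} (c : ℝ) (F : (Fin n → Bool) → ℝ) :
    pEW w (fun ξ => c * F ξ) = c * pEW w F := by
  simp only [pEW, Finset.mul_sum]
  refine Finset.sum_congr rfl fun ξ _ => ?_
  ring

lemma pEW_mono (w : Bool → ℝ) (hw : ∀ b, 0 ≤ w b) {n : ℕ} (F G : (Fin n → Bool) → ℝ)
    (h : ∀ ξ, F ξ ≤ G ξ) : pEW w F ≤ pEW w G :=
  Finset.sum_le_sum fun ξ _ => mul_le_mul_of_nonneg_left (h ξ) (Finset.prod_nonneg fun _ _ => hw _)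

lemma linF_cons (d : Bool → ℝ) {n : ℕ} (a : Fin (n+1) → ℝ) (b : Bool) (ξ : Fin n → Bool) :
    linF d a (Fin.cons b ξ) = a 0 * d b + linF d (fun i => a i.succ) ξ := by
  simp [linF, Fin.sum_univ_succ]

lemma amgm_aux {s a t : ℝ} (hs : 0 ≤ s) (ht : t ^ 2 ≤ s ^ 3) :
    |2 * (a ^ 3 * t)| ≤ a ^ 2 * s ^ 2 + a ^ 4 * s := by
  apply abs_le_of_sq_le_sq
  · have h1 : (a ^ 3) ^ 2 * t ^ 2 ≤ (a ^ 3) ^ 2 * s ^ 3 :=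
      mul_le_mul_of_nonneg_left ht (sq_nonneg _)
    nlinarith [sq_nonneg (a ^ 2 * s ^ 2 - a ^ 4 * s)]
  · positivity

lemma step_aux {s a t γ M4 M6 : ℝ} (hs : 0 ≤ s) (hγ : γ ^ 2 ≤ 9 / 5)
    (am : 2 * (a ^ 3 * t) ≤ a ^ 2 * s ^ 2 + a ^ 4 * s) (l4 : (1 + γ ^ 2) * s ^ 2 ≤ M4)
    (u4 : M4 ≤ 3 * s ^ 2) (u6 : M6 ≤ 21 * s ^ 3) :
    (1 + γ ^ 2) * (a ^ 2 + s) ^ 2 ≤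
      M4 + ((6 * a ^ 2) * s + ((4 * a ^ 3 * γ) * 0 + (a ^ 4 * (1 + γ ^ 2)) * 1)) ∧
    M4 + ((6 * a ^ 2) * s + ((4 * a ^ 3 * γ) * 0 + (a ^ 4 * (1 + γ ^ 2)) * 1)) ≤
      3 * (a ^ 2 + s) ^ 2 ∧
    M6 + ((15 * a ^ 2) * M4 + ((20 * a ^ 3 * γ) * (γ * t) + ((15 * a ^ 4 * (1 + γ ^ 2)) * s
      + ((6 * a ^ 5 * (2 * γ + γ ^ 3)) * 0 + (a ^ 6 * (1 + 3 * γ ^ 2 + γ ^ 4)) * 1)))) ≤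
      21 * (a ^ 2 + s) ^ 3 := by
  have p1 : 0 ≤ a ^ 2 * s := by positivity
  have p2 : 0 ≤ a ^ 2 * s ^ 2 := by positivity
  have p3 : 0 ≤ a ^ 4 * s := by positivity
  have p4 : 0 ≤ a ^ 6 := by positivity
  have p5 : 0 ≤ a ^ 4 := by positivity
  refine ⟨?_, ?_, ?_⟩
  · linarith [mul_le_mul_of_nonneg_right hγ p1]
  · linarith [mul_le_mul_of_nonneg_right hγ p5]
  · have k1 : a ^ 2 * M4 ≤ a ^ 2 * (3 * s ^ 2) := mul_le_mul_of_nonneg_left u4 (sq_nonneg a)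
    have k2 : γ ^ 2 * (2 * (a ^ 3 * t)) ≤ γ ^ 2 * (a ^ 2 * s ^ 2 + a ^ 4 * s) :=
      mul_le_mul_of_nonneg_left am (sq_nonneg γ)
    have k3 := mul_le_mul_of_nonneg_right hγ p2
    have k4 := mul_le_mul_of_nonneg_right hγ p3
    have k5 : a ^ 6 * (1 + 3 * γ ^ 2 + γ ^ 4) ≤ a ^ 6 * 21 :=
      mul_le_mul_of_nonneg_left (by nlinarith [sq_nonneg γ]) p4
    linarith

lemma moments (w d : Bool → ℝ) (γ : ℝ) (hw1 : w false + w true = 1)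
    (hd1 : w false * d false + w true * d true = 0) (hd2 : ∀ b, d b ^ 2 = 1 + γ * d b)
    (n : ℕ) (a : Fin n → ℝ) :
    pEW w (n := n) (fun _ => 1) = 1 ∧ pEW w (linF d a) = 0 ∧
    pEW w (fun ξ => linF d a ξ ^ 2) = ∑ i, a i ^ 2 ∧
    (∃ t : ℝ, pEW w (fun ξ => linF d a ξ ^ 3) = γ * t ∧ t ^ 2 ≤ (∑ i, a i ^ 2) ^ 3) ∧
    (γ ^ 2 ≤ 9 / 5 → (1 + γ ^ 2) * (∑ i, a i ^ 2) ^ 2 ≤ pEW w (fun ξ => linF d a ξ ^ 4) ∧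
      pEW w (fun ξ => linF d a ξ ^ 4) ≤ 3 * (∑ i, a i ^ 2) ^ 2 ∧
      pEW w (fun ξ => linF d a ξ ^ 6) ≤ 21 * (∑ i, a i ^ 2) ^ 3) := by
  have e2 : ∀ b, d b ^ 2 = 1 + γ * d b := hd2
  have e3 : ∀ b, d b ^ 3 = γ + (1 + γ ^ 2) * d b := fun b => by
    linear_combination (d b + γ) * e2 b
  have e4 : ∀ b, d b ^ 4 = (1 + γ ^ 2) + (2 * γ + γ ^ 3) * d b := fun b => by
    linear_combination d b * e3 b + (1 + γ ^ 2) * e2 b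
  have e5 : ∀ b, d b ^ 5 = (2 * γ + γ ^ 3) + (1 + 3 * γ ^ 2 + γ ^ 4) * d b := fun b => by
    linear_combination d b * e4 b + (2 * γ + γ ^ 3) * e2 b
  have e6 : ∀ b, d b ^ 6 = (1 + 3 * γ ^ 2 + γ ^ 4) + (3 * γ + 4 * γ ^ 3 + γ ^ 5) * d b :=
    fun b => by
    linear_combination d b * e5 b + (1 + 3 * γ ^ 2 + γ ^ 4) * e2 b
  have m2 : w false * d false ^ 2 + w true * d true ^ 2 = 1 := by
    rw [e2, e2]; linear_combination hw1 + γ * hd1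
  have m3 : w false * d false ^ 3 + w true * d true ^ 3 = γ := by
    rw [e3, e3]; linear_combination γ * hw1 + (1 + γ ^ 2) * hd1
  have m4 : w false * d false ^ 4 + w true * d true ^ 4 = 1 + γ ^ 2 := by
    rw [e4, e4]; linear_combination (1 + γ ^ 2) * hw1 + (2 * γ + γ ^ 3) * hd1
  have m5 : w false * d false ^ 5 + w true * d true ^ 5 = 2 * γ + γ ^ 3 := by
    rw [e5, e5]; linear_combination (2 * γ + γ ^ 3) * hw1 + (1 + 3 * γ ^ 2 + γ ^ 4) * hd1
  have m6 : w false * d false ^ 6 + w true * d true ^ 6 = 1 + 3 * γ ^ 2 + γ ^ 4 := by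
    rw [e6, e6]
    linear_combination (1 + 3 * γ ^ 2 + γ ^ 4) * hw1 + (3 * γ + 4 * γ ^ 3 + γ ^ 5) * hd1
  clear e2 e3 e4 e5 e6
  induction n with
  | zero =>
    refine ⟨?_, ?_, ?_, ⟨0, ?_, ?_⟩, fun _ => ⟨?_, ?_, ?_⟩⟩ <;> simp [pEW, linF]
  | succ n ih =>
    obtain ⟨h0, h1, h2, ⟨t, h3, ht⟩, h46⟩ := ih (fun i => a i.succ)
    have q0 : pEW w (n := n + 1) (fun _ => 1) = pEW w (n := n) (fun _ => 1) := by
      rw [pEW_succ]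
      congr 1; funext ξ; linarith
    have q1 : pEW w (linF d a) = pEW w (linF d (fun i => a i.succ)) := by
      rw [pEW_succ]
      congr 1; funext ξ
      rw [linF_cons, linF_cons]
      linear_combination (linF d (fun i => a i.succ) ξ) * hw1 + a 0 * hd1
    have q2 : pEW w (fun ξ => linF d a ξ ^ 2) =
        pEW w (fun ξ => linF d (fun i => a i.succ) ξ ^ 2) + a 0 ^ 2 * pEW w (n := n) (fun _ => 1) := by
      rw [pEW_succ, ← pEW_mul, ← pEW_add]
      congr 1; funext ξ
      simp only [linF_cons]
      generalize linF d (fun i => a i.succ) ξ = Y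
      linear_combination (Y ^ 2) * hw1 + 2 * Y * a 0 * hd1 + a 0 ^ 2 * m2
    have q3 : pEW w (fun ξ => linF d a ξ ^ 3) =
        pEW w (fun ξ => linF d (fun i => a i.succ) ξ ^ 3)
        + ((3 * a 0 ^ 2) * pEW w (linF d (fun i => a i.succ))
        + (a 0 ^ 3 * γ) * pEW w (n := n) (fun _ => 1)) := by
      rw [pEW_succ]
      simp only [← pEW_mul, ← pEW_add]
      congr 1; funext ξ
      simp only [linF_cons]
      generalize linF d (fun i => a i.succ) ξ = Y
      linear_combination (Y ^ 3) * hw1 + 3 * Y ^ 2 * a 0 * hd1 + 3 * Y * a 0 ^ 2 * m2 + a 0 ^ 3 * m3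
    have q4 : pEW w (fun ξ => linF d a ξ ^ 4) =
        pEW w (fun ξ => linF d (fun i => a i.succ) ξ ^ 4)
        + ((6 * a 0 ^ 2) * pEW w (fun ξ => linF d (fun i => a i.succ) ξ ^ 2)
        + ((4 * a 0 ^ 3 * γ) * pEW w (linF d (fun i => a i.succ))
        + (a 0 ^ 4 * (1 + γ ^ 2)) * pEW w (n := n) (fun _ => 1))) := by
      rw [pEW_succ]
      simp only [← pEW_mul, ← pEW_add]
      congr 1; funext ξ
      simp only [linF_cons]
      generalize linF d (fun i => a i.succ) ξ = Y
      linear_combination (Y ^ 4) * hw1 + 4 * Y ^ 3 * a 0 * hd1 + 6 * Y ^ 2 * a 0 ^ 2 * m2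
        + 4 * Y * a 0 ^ 3 * m3 + a 0 ^ 4 * m4
    have q6 : pEW w (fun ξ => linF d a ξ ^ 6) =
        pEW w (fun ξ => linF d (fun i => a i.succ) ξ ^ 6)
        + ((15 * a 0 ^ 2) * pEW w (fun ξ => linF d (fun i => a i.succ) ξ ^ 4)
        + ((20 * a 0 ^ 3 * γ) * pEW w (fun ξ => linF d (fun i => a i.succ) ξ ^ 3)
        + ((15 * a 0 ^ 4 * (1 + γ ^ 2)) * pEW w (fun ξ => linF d (fun i => a i.succ) ξ ^ 2)
        + ((6 * a 0 ^ 5 * (2 * γ + γ ^ 3)) * pEW w (linF d (fun i => a i.succ))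
        + (a 0 ^ 6 * (1 + 3 * γ ^ 2 + γ ^ 4)) * pEW w (n := n) (fun _ => 1))))) := by
      rw [pEW_succ]
      simp only [← pEW_mul, ← pEW_add]
      congr 1; funext ξ
      simp only [linF_cons]
      generalize linF d (fun i => a i.succ) ξ = Y
      linear_combination (Y ^ 6) * hw1 + 6 * Y ^ 5 * a 0 * hd1 + 15 * Y ^ 4 * a 0 ^ 2 * m2
        + 20 * Y ^ 3 * a 0 ^ 3 * m3 + 15 * Y ^ 2 * a 0 ^ 4 * m4 + 6 * Y * a 0 ^ 5 * m5
        + a 0 ^ 6 * m6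
    have hs : 0 ≤ ∑ i : Fin n, a i.succ ^ 2 := Finset.sum_nonneg fun i _ => sq_nonneg _
    rw [q2, q3, q4, q6, h0, h1, h2, h3]
    simp only [Fin.sum_univ_succ (fun i => a i ^ 2)]
    generalize (∑ i : Fin n, a i.succ ^ 2) = s at *
    generalize a 0 = a at *
    have am := amgm_aux (a := a) hs ht
    rw [abs_le] at am
    refine ⟨?_, ?_, ?_, ⟨t + a ^ 3, ?_, ?_⟩, fun hγ => ?_⟩
    · exact q0.trans h0
    · exact q1.trans h1
    · ring
    · ring
    · nlinarith [mul_nonneg (sq_nonneg a) (sq_nonneg s), mul_nonneg (sq_nonneg (a ^ 2)) hs]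
    · obtain ⟨l4, u4, u6⟩ := h46 hγ
      exact step_aux hs hγ am.2 l4 u4 u6

lemma poly_bound (z : ℝ) :
    |z| ≤ (1 + z ^ 2) / 2 - (z ^ 2 - 1) ^ 2 * (1 - z ^ 2 / 28) / 28 := by
  have h : z ^ 2 = |z| ^ 2 := (sq_abs z).symm
  rw [h]
  have hz := abs_nonneg z
  generalize |z| = y at *
  have key : (1 + y) ^ 2 * (1 - y ^ 2 / 28) ≤ 14 := by
    nlinarith [sq_nonneg (y ^ 2 - 12), sq_nonneg (y - 7/2), mul_nonneg hz (sq_nonneg (y - 7/2)),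
      sq_nonneg (y ^ 2 + y - 63/4), sq_nonneg (y^2 - 7/2*y)]
  nlinarith [mul_le_mul_of_nonneg_left key (sq_nonneg (y - 1))]

lemma abs_lin_le (w d : Bool → ℝ) (γ : ℝ) (hw : ∀ b, 0 ≤ w b) (hw1 : w false + w true = 1)
    (hd1 : w false * d false + w true * d true = 0) (hd2 : ∀ b, d b ^ 2 = 1 + γ * d b)
    (n : ℕ) (a : Fin n → ℝ) :
    pEW w (fun ξ => |linF d a ξ|) ≤ Real.sqrt (∑ i, a i ^ 2) ∧
    (4 / 3 ≤ γ ^ 2 → γ ^ 2 ≤ 9 / 5 →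
      pEW w (fun ξ => |linF d a ξ|) ≤ (49 / 50) * Real.sqrt (∑ i, a i ^ 2)) := by
  have hs : 0 ≤ ∑ i, a i ^ 2 := Finset.sum_nonneg fun i _ => sq_nonneg _
  rcases hs.eq_or_lt with h | h
  · have ha : ∀ i, a i = 0 := fun i => by
      have := (Finset.sum_eq_zero_iff_of_nonneg (fun i _ => sq_nonneg (a i))).1 h.symm i
        (Finset.mem_univ i)
      simpa using this
    rw [← h]
    simp [linF, ha, pEW]
  · have hr : 0 < Real.sqrt (∑ i, a i ^ 2) := Real.sqrt_pos.2 h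
    set r := Real.sqrt (∑ i, a i ^ 2) with hrdef
    have hr2 : r ^ 2 = ∑ i, a i ^ 2 := Real.sq_sqrt hs
    -- normalize
    have hb : ∑ i, (a i / r) ^ 2 = 1 := by
      simp only [div_pow]
      rw [← Finset.sum_div, ← hr2, div_self (by positivity)]
    have hX : ∀ ξ, |linF d a ξ| = r * |linF d (fun i => a i / r) ξ| := fun ξ => by
      have : linF d a ξ = r * linF d (fun i => a i / r) ξ := by
        simp only [linF, Finset.mul_sum]
        refine Finset.sum_congr rfl fun i _ => ?_
        field_simp
      rw [this, abs_mul, abs_of_pos hr]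
    simp only [hX]
    rw [pEW_mul]
    obtain ⟨h0, h1, h2, -, h46⟩ := moments w d γ hw1 hd1 hd2 n (fun i => a i / r)
    rw [hb] at h2 h46
    constructor
    · have : pEW w (fun ξ => |linF d (fun i => a i / r) ξ|) ≤
          pEW w (fun ξ => (1/2) * 1 + (1/2) * linF d (fun i => a i / r) ξ ^ 2) := by
        refine pEW_mono w hw _ _ fun ξ => ?_
        have := sq_nonneg (|linF d (fun i => a i / r) ξ| - 1)
        nlinarith [sq_abs (linF d (fun i => a i / r) ξ)]
      rw [pEW_add, pEW_mul, pEW_mul, h0, h2] at this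
      nlinarith
    · intro g1 g2
      obtain ⟨l4, u4, u6⟩ := h46 g2
      have : pEW w (fun ξ => |linF d (fun i => a i / r) ξ|) ≤
          pEW w (fun ξ => (1/2 - 1/28) * 1 + ((1/2 + 2/28 + 1/784) * linF d (fun i => a i / r) ξ ^ 2
            + ((-1/28 - 2/784) * linF d (fun i => a i / r) ξ ^ 4
            + (1/784) * linF d (fun i => a i / r) ξ ^ 6))) := by
        refine pEW_mono w hw _ _ fun ξ => ?_
        have := poly_bound (linF d (fun i => a i / r) ξ)
        nlinarith
      rw [pEW_add, pEW_add, pEW_add, pEW_mul, pEW_mul, pEW_mul, pEW_mul, h0, h2] at this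
      have : pEW w (fun ξ => |linF d (fun i => a i / r) ξ|) ≤ 49 / 50 := by
        nlinarith
      nlinarith

/-- sign of a bit: `true` means a flip -/
noncomputable def sgB (b : Bool) : ℝ := if b then -1 else 1

/-- flip of a coordinate -/
def flipC {n : ℕ} (j : Fin n) (x : Fin n → Bool) : Fin n → Bool := Function.update x j (!(x j))

lemma flipC_invol {n : ℕ} (j : Fin n) : Function.Involutive (flipC j) := by
  intro x
  simp [flipC]

lemma sgB_not (b : Bool) : sgB (!b) = - sgB b := by cases b <;> simp [sgB]

lemma sgB_sq (b : Bool) : sgB b ^ 2 = 1 := by cases b <;> simp [sgB]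

noncomputable def wB (ρ : ℝ) (b : Bool) : ℝ := (1 + ρ * sgB b) / 2

lemma wB_deriv (ρ : ℝ) (b : Bool) : HasDerivAt (fun r => wB r b) (sgB b / 2) ρ := by
  unfold wB
  have := (((hasDerivAt_id ρ).mul_const (sgB b)).const_add 1).div_const 2
  simpa using this

lemma pEW_deriv {n : ℕ} (g : (Fin n → Bool) → ℝ) (ρ : ℝ) (hρ : 1 - ρ ^ 2 ≠ 0) :
    HasDerivAt (fun r => pEW (wB r) g)
      (pEW (wB ρ) (fun ξ => ∑ j, discDeriv g j ξ * ((sgB (ξ j) - ρ) / (1 - ρ ^ 2)))) ρ := by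
  have h : HasDerivAt (fun r => pEW (wB r) g)
      (∑ ξ : Fin n → Bool, (∑ j, (∏ i ∈ Finset.univ.erase j, wB ρ (ξ i)) * (sgB (ξ j) / 2)) * g ξ)
      ρ := by
    unfold pEW
    refine HasDerivAt.fun_sum fun ξ _ => ?_
    refine HasDerivAt.mul_const ?_ _
    have := HasDerivAt.fun_finsetProd (u := Finset.univ) (f := fun i r => wB r (ξ i))
      (f' := fun i => sgB (ξ i) / 2) (x := ρ) (fun i _ => wB_deriv ρ (ξ i))
    simpa [smul_eq_mul] using this
  convert h using 1
  simp only [pEW, Finset.mul_sum, Finset.sum_mul]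
  rw [Finset.sum_comm, Finset.sum_comm (γ := Fin n → Bool)]
  refine Finset.sum_congr rfl fun j _ => ?_
  have hP : ∀ ξ : Fin n → Bool, ∏ i ∈ Finset.univ.erase j, wB ρ (flipC j ξ i) =
      ∏ i ∈ Finset.univ.erase j, wB ρ (ξ i) := fun ξ => by
    refine Finset.prod_congr rfl fun i hi => ?_
    rw [flipC, Function.update_of_ne (Finset.ne_of_mem_erase hi)]
  have hf : ∑ ξ : Fin n → Bool, (∏ i ∈ Finset.univ.erase j, wB ρ (ξ i)) * (sgB (ξ j) / 2) * g ξ =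
      ∑ ξ : Fin n → Bool,
        -((∏ i ∈ Finset.univ.erase j, wB ρ (ξ i)) * (sgB (ξ j) / 2) * g (flipC j ξ)) := by
    rw [← Equiv.sum_comp (flipC_invol j).toPerm]
    refine Finset.sum_congr rfl fun ξ _ => ?_
    simp only [Function.Involutive.coe_toPerm]
    rw [hP]
    have : sgB (flipC j ξ j) = - sgB (ξ j) := by simp [flipC, sgB_not]
    rw [this]; ring
  have h2 : ∑ ξ : Fin n → Bool, (∏ i, wB ρ (ξ i)) *
        (discDeriv g j ξ * ((sgB (ξ j) - ρ) / (1 - ρ ^ 2))) =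
      (1/2) * ∑ ξ : Fin n → Bool, (∏ i ∈ Finset.univ.erase j, wB ρ (ξ i)) * (sgB (ξ j) / 2) * g ξ +
      (1/2) * ∑ ξ : Fin n → Bool,
        -((∏ i ∈ Finset.univ.erase j, wB ρ (ξ i)) * (sgB (ξ j) / 2) * g (flipC j ξ)) := by
    rw [Finset.mul_sum, Finset.mul_sum, ← Finset.sum_add_distrib]
    refine Finset.sum_congr rfl fun ξ _ => ?_
    rw [← Finset.mul_prod_erase Finset.univ _ (Finset.mem_univ j)]
    generalize ∏ i ∈ Finset.univ.erase j, wB ρ (ξ i) = P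
    have hk : wB ρ (ξ j) * ((sgB (ξ j) - ρ) / (1 - ρ ^ 2)) = sgB (ξ j) / 2 := by
      unfold wB
      field_simp
      linear_combination ρ * sgB_sq (ξ j)
    have : discDeriv g j ξ = (g ξ - g (flipC j ξ)) / 2 := rfl
    rw [this]
    linear_combination (P * ((g ξ - g (flipC j ξ)) / 2)) * hk
  rw [h2, ← hf]; ring

/-- translation on the cube -/
def xorC {n : ℕ} (ξ x : Fin n → Bool) : Fin n → Bool := fun i => xor (ξ i) (x i)

lemma discDeriv_xor {n : ℕ} (f : (Fin n → Bool) → ℝ) (x : Fin n → Bool) (j : Fin n)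
    (ξ : Fin n → Bool) :
    discDeriv (fun ξ => f (xorC ξ x)) j ξ = discDeriv f j (xorC ξ x) := by
  unfold discDeriv
  show (f (xorC ξ x) - f (xorC (Function.update ξ j (!ξ j)) x)) / 2 = _
  congr 3
  funext i
  by_cases h : i = j
  · subst h; simp [xorC]
  · simp [xorC, h]

lemma sum_xor {n : ℕ} (F : (Fin n → Bool) → ℝ) (ξ : Fin n → Bool) :
    ∑ x, F (xorC ξ x) = ∑ x, F x := by
  have hi : Function.Involutive (xorC ξ) := fun x => by funext i; simp [xorC]
  exact Equiv.sum_comp hi.toPerm F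

/-- The interpolation functional. -/
noncomputable def interp {n : ℕ} (s f : (Fin n → Bool) → ℝ) (θ : ℝ) : ℝ :=
  ∑ x, s x * pEW (wB (Real.cos θ)) (fun ξ => f (xorC ξ x))

lemma interp_deriv {n : ℕ} (s f : (Fin n → Bool) → ℝ) (θ : ℝ) (hθ : Real.sin θ ≠ 0) :
    HasDerivAt (interp s f)
      (- ∑ x, s x * pEW (wB (Real.cos θ)) (fun ξ =>
        linF (fun b => (sgB b - Real.cos θ) / Real.sin θ)
          (fun j => discDeriv f j (xorC ξ x)) ξ)) θ := by
  have hc : 1 - Real.cos θ ^ 2 = Real.sin θ ^ 2 := by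
    linear_combination -(Real.sin_sq_add_cos_sq θ)
  have h : HasDerivAt (interp s f)
      (∑ x, s x * (pEW (wB (Real.cos θ)) (fun ξ => ∑ j, discDeriv (fun ξ => f (xorC ξ x)) j ξ *
        ((sgB (ξ j) - Real.cos θ) / (1 - Real.cos θ ^ 2))) * (-Real.sin θ))) θ := by
    unfold interp
    refine HasDerivAt.fun_sum fun x _ => ?_
    refine HasDerivAt.const_mul _ ?_
    have h1 := pEW_deriv (fun ξ => f (xorC ξ x)) (Real.cos θ) (by rw [hc]; positivity)
    exact h1.comp θ (Real.hasDerivAt_cos θ)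
  convert h using 1
  rw [← Finset.sum_neg_distrib]
  refine Finset.sum_congr rfl fun x _ => ?_
  rw [mul_comm (pEW _ _) (-Real.sin θ), neg_mul, mul_neg, ← pEW_mul _ (Real.sin θ)]
  congr 3
  funext ξ
  simp only [linF, Finset.mul_sum, hc, discDeriv_xor]
  refine Finset.sum_congr rfl fun j _ => ?_
  field_simp

lemma interp_deriv_bound {n : ℕ} (s f : (Fin n → Bool) → ℝ) (hs : ∀ x, |s x| ≤ 1) (θ c : ℝ)
    (hθ : 0 < Real.sin θ)
    (hc : ∀ a : Fin n → ℝ, pEW (wB (Real.cos θ)) (fun ξ =>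
      |linF (fun b => (sgB b - Real.cos θ) / Real.sin θ) a ξ|) ≤ c * Real.sqrt (∑ i, a i ^ 2)) :
    -deriv (interp s f) θ ≤ c * ∑ x, discGradNorm f x := by
  rw [(interp_deriv s f θ hθ.ne').deriv, neg_neg]
  set d : Bool → ℝ := fun b => (sgB b - Real.cos θ) / Real.sin θ
  have hw : ∀ b, 0 ≤ wB (Real.cos θ) b := fun b => by
    cases b <;> simp [wB, sgB] <;> linarith [Real.cos_le_one θ, Real.neg_one_le_cos θ]
  calc ∑ x, s x * pEW (wB (Real.cos θ)) (fun ξ => linF d (fun j => discDeriv f j (xorC ξ x)) ξ)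
      ≤ ∑ x, pEW (wB (Real.cos θ)) (fun ξ => |linF d (fun j => discDeriv f j (xorC ξ x)) ξ|) := by
        refine Finset.sum_le_sum fun x _ => ?_
        rw [← pEW_mul]
        refine pEW_mono _ hw _ _ fun ξ => ?_
        refine (le_abs_self _).trans ?_
        rw [abs_mul]
        exact mul_le_of_le_one_left (abs_nonneg _) (hs x)
    _ = pEW (wB (Real.cos θ)) (fun ξ => ∑ x, |linF d (fun j => discDeriv f j (xorC ξ x)) ξ|) := by
        simp only [pEW, Finset.mul_sum]
        rw [Finset.sum_comm]
    _ = pEW (wB (Real.cos θ)) (fun ξ => ∑ y, |linF d (fun j => discDeriv f j y) ξ|) := by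
        congr 1; funext ξ
        exact sum_xor (fun y => |linF d (fun j => discDeriv f j y) ξ|) ξ
    _ = ∑ y, pEW (wB (Real.cos θ)) (fun ξ => |linF d (fun j => discDeriv f j y) ξ|) := by
        simp only [pEW, Finset.mul_sum]
        rw [Finset.sum_comm]
    _ ≤ ∑ y, c * discGradNorm f y := Finset.sum_le_sum fun y _ => hc _
    _ = c * ∑ x, discGradNorm f x := by rw [Finset.mul_sum]

lemma bias_bound {n : ℕ} (θ : ℝ) (hθ : 0 < Real.sin θ) (a : Fin n → ℝ) :
    pEW (wB (Real.cos θ)) (fun ξ => |linF (fun b => (sgB b - Real.cos θ) / Real.sin θ) a ξ|) ≤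
      1 * Real.sqrt (∑ i, a i ^ 2) ∧
    (1 / 4 ≤ Real.cos θ ^ 2 → Real.cos θ ^ 2 ≤ 25 / 81 →
    pEW (wB (Real.cos θ)) (fun ξ => |linF (fun b => (sgB b - Real.cos θ) / Real.sin θ) a ξ|) ≤
      49 / 50 * Real.sqrt (∑ i, a i ^ 2)) := by
  have hsc := Real.sin_sq_add_cos_sq θ
  obtain ⟨h1, h2⟩ := abs_lin_le (wB (Real.cos θ)) (fun b => (sgB b - Real.cos θ) / Real.sin θ)
    (-2 * Real.cos θ / Real.sin θ)
    (fun b => by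
      cases b <;> simp [wB, sgB] <;> linarith [Real.cos_le_one θ, Real.neg_one_le_cos θ])
    (by simp [wB, sgB]; ring)
    (by simp [wB, sgB]; field_simp; ring)
    (fun b => by
      field_simp
      linear_combination sgB_sq b - hsc) n a
  refine ⟨by simpa using h1, fun g1 g2 => h2 ?_ ?_⟩
  · rw [div_pow, le_div_iff₀ (by positivity)]; nlinarith
  · rw [div_pow, div_le_iff₀ (by positivity)]; nlinarith

lemma interp_zero {n : ℕ} (s f : (Fin n → Bool) → ℝ) : interp s f 0 = ∑ x, s x * f x := by
  unfold interp
  refine Finset.sum_congr rfl fun x _ => ?_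
  congr 1
  unfold pEW
  rw [Finset.sum_eq_single (fun _ => false)]
  · have : xorC (fun _ => false) x = x := by funext i; simp [xorC]
    simp [wB, sgB, this]
  · intro ξ _ hξ
    obtain ⟨i, hi⟩ : ∃ i, ξ i ≠ false := Function.ne_iff.1 hξ
    have : ∏ i, wB (Real.cos 0) (ξ i) = 0 :=
      Finset.prod_eq_zero (Finset.mem_univ i) (by simp at hi; simp [hi, wB, sgB])
    rw [this, zero_mul]
  · simp

lemma interp_end {n : ℕ} (s f : (Fin n → Bool) → ℝ) :
    interp s f (π / 2) = ∑ x, s x * cubeExp f := by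
  unfold interp
  refine Finset.sum_congr rfl fun x _ => ?_
  congr 1
  have : ∑ ξ, f (xorC ξ x) = ∑ ξ, f ξ := by
    rw [← sum_xor f x]
    refine Finset.sum_congr rfl fun ξ _ => ?_
    congr 1; funext i; simp [xorC, Bool.xor_comm]
  simp only [pEW, wB, Real.cos_pi_div_two, cubeExp, zero_mul, add_zero, Finset.prod_const,
    Finset.card_univ, Fintype.card_fin]
  rw [← Finset.mul_sum, this]
  simp [div_eq_mul_inv, mul_comm]

lemma interp_cont {n : ℕ} (s f : (Fin n → Bool) → ℝ) : Continuous (interp s f) := by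
  unfold interp pEW wB
  fun_prop

lemma interp_mvt {n : ℕ} (s f : (Fin n → Bool) → ℝ) (hs : ∀ x, |s x| ≤ 1) (u v c : ℝ)
    (hu : 0 ≤ u) (huv : u ≤ v) (hv : v ≤ π / 2)
    (hc : ∀ θ, u < θ → θ < v → ∀ a : Fin n → ℝ, pEW (wB (Real.cos θ)) (fun ξ =>
      |linF (fun b => (sgB b - Real.cos θ) / Real.sin θ) a ξ|) ≤ c * Real.sqrt (∑ i, a i ^ 2)) :
    interp s f u - interp s f v ≤ c * (∑ x, discGradNorm f x) * (v - u) := by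
  have hsin : ∀ θ, u < θ → θ < v → 0 < Real.sin θ := fun θ h1 h2 =>
    Real.sin_pos_of_pos_of_lt_pi (by linarith) (by linarith [Real.pi_pos])
  have := Convex.image_sub_le_mul_sub_of_deriv_le (convex_Icc u v)
    (f := fun θ => - interp s f θ) (interp_cont s f).neg.continuousOn
    (by
      rw [interior_Icc]
      intro θ hθ
      exact (interp_deriv s f θ (hsin θ hθ.1 hθ.2).ne').neg.differentiableAt.differentiableWithinAt)
    (C := c * ∑ x, discGradNorm f x)
    (by
      rw [interior_Icc]
      intro θ hθ
      rw [deriv.fun_neg]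
      exact interp_deriv_bound s f hs θ c (hsin θ hθ.1 hθ.2) (hc θ hθ.1 hθ.2))
    u ⟨le_rfl, huv⟩ v ⟨huv, le_rfl⟩ huv
  linarith

/-- **Improved L¹ Poincaré inequality on the hypercube.** For every `n ≥ 1` and every
`f : {-1,1}ⁿ → ℝ` one has `E|f - E f| ≤ (π/2 - δ) E|∇f|` with `δ = 10⁻⁴`. -/
theorem l1_poincare_improved (n : ℕ) (hn : 1 ≤ n) (f : (Fin n → Bool) → ℝ) :
    cubeExp (fun x => |f x - cubeExp f|) ≤
      (π / 2 - 1 / 10000) * cubeExp (fun x => discGradNorm f x) := by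
  set s : (Fin n → Bool) → ℝ := fun x => if 0 ≤ f x - cubeExp f then 1 else -1 with hsdef
  have hs : ∀ x, |s x| ≤ 1 := fun x => by
    simp only [hsdef]; split_ifs <;> simp
  have hpi := Real.pi_gt_d2
  have hpi' := Real.pi_lt_d2
  have hK : 0 ≤ ∑ x, discGradNorm f x := Finset.sum_nonneg fun x _ => Real.sqrt_nonneg _
  have hsin : ∀ θ, 0 < θ → θ < π / 2 → 0 < Real.sin θ := fun θ h1 h2 =>
    Real.sin_pos_of_pos_of_lt_pi (by linarith) (by linarith)
  have i1 := interp_mvt s f hs 0 1 1 le_rfl zero_le_one (by linarith)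
    (fun θ h1 h2 a => (bias_bound θ (hsin θ h1 (by linarith)) a).1)
  have i2 := interp_mvt s f hs 1 (π / 3) (49 / 50) zero_le_one (by linarith) (by linarith)
    (fun θ h1 h2 a => (bias_bound θ (hsin θ (by linarith) (by linarith)) a).2
      (by
        have : Real.cos (π / 3) ≤ Real.cos θ :=
          Real.cos_le_cos_of_nonneg_of_le_pi (by linarith) (by linarith) h2.le
        rw [Real.cos_pi_div_three] at this
        nlinarith)
      (by
        have h3 : Real.cos θ ≤ Real.cos 1 :=
          Real.cos_le_cos_of_nonneg_of_le_pi (by linarith) (by linarith) h1.le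
        have h4 : 0 ≤ Real.cos θ := Real.cos_nonneg_of_neg_pi_div_two_le_of_le
          (by linarith) (by linarith)
        have := Real.cos_one_le
        nlinarith))
  have i3 := interp_mvt s f hs (π / 3) (π / 2) 1 (by linarith) (by linarith) le_rfl
    (fun θ h1 h2 a => (bias_bound θ (hsin θ (by linarith) h2) a).1)
  have hsum : ∑ x, |f x - cubeExp f| = interp s f 0 - interp s f (π / 2) := by
    rw [interp_zero, interp_end, ← Finset.sum_sub_distrib]
    refine Finset.sum_congr rfl fun x _ => ?_
    rw [← mul_sub]
    simp only [hsdef]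
    split_ifs with h
    · rw [abs_of_nonneg h, one_mul]
    · rw [abs_of_neg (not_le.1 h)]; ring
  have main : ∑ x, |f x - cubeExp f| ≤ (π / 2 - 1 / 10000) * ∑ x, discGradNorm f x := by
    rw [hsum]
    nlinarith
  have e1 : cubeExp (fun x => |f x - cubeExp f|) = (∑ x, |f x - cubeExp f|) / 2 ^ n := rfl
  have e2 : cubeExp (fun x => discGradNorm f x) = (∑ x, discGradNorm f x) / 2 ^ n := rfl
  rw [e1, e2, ← mul_div_assoc]
  exact div_le_div_of_nonneg_right main (by positivity)
end

section
/- For all real numbers $a, c \in (0,1)$ and every real $p > 2$, one has $B(a,c,p) \geq \min\{1, p-2\}$, where $B(a,c,p) = \dfrac{c^{p-2}(a^p - 1) + c^p(a^2 - a^p) + 1 - a^2}{(1-c)(1-a)(1-ac)}$. -/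
/-- **Lower bound lemma.** For all `a, c ∈ (0,1)` and all real `p > 2`,
`B(a,c,p) = (c^(p-2)(aᵖ-1) + cᵖ(a²-aᵖ) + 1-a²) / ((1-c)(1-a)(1-ac)) ≥ min{1, p-2}`. -/
theorem B_lower_bound (a c p : ℝ) (ha : a ∈ Set.Ioo (0 : ℝ) 1)
    (hc : c ∈ Set.Ioo (0 : ℝ) 1) (hp : 2 < p) :
    min 1 (p - 2) ≤
      (c ^ (p - 2) * (a ^ p - 1) + c ^ p * (a ^ 2 - a ^ p) + 1 - a ^ 2) /
        ((1 - c) * (1 - a) * (1 - a * c)) := by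
  obtain ⟨ha0, ha1⟩ := ha
  obtain ⟨hc0, hc1⟩ := hc
  obtain ⟨q, rfl⟩ : ∃ q, p = q + 2 := ⟨p - 2, by ring⟩
  have hq : 0 < q := by linarith
  have hac : a * c < 1 := by nlinarith
  have hA : 0 < 1 - a := by linarith
  have hC : 0 < 1 - c := by linarith
  have hAC : 0 < 1 - a * c := by linarith
  have hCA : 0 < (1 - c) * (1 - a) := mul_pos hC hA
  have e1 : a ^ (q + 2) = a ^ q * a ^ 2 := by
    rw [Real.rpow_add ha0]; norm_num
  have e2 : c ^ (q + 2) = c ^ q * c ^ 2 := by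
    rw [Real.rpow_add hc0]; norm_num
  rw [le_div_iff₀ (mul_pos hCA hAC), e1, e2, show q + 2 - 2 = q by ring]
  have hu0 : 0 < c ^ q := Real.rpow_pos_of_pos hc0 q
  have hu1 : c ^ q ≤ 1 := Real.rpow_le_one hc0.le hc1.le hq.le
  have hv1 : a ^ q ≤ 1 := Real.rpow_le_one ha0.le ha1.le hq.le
  have hN : c ^ q * (a ^ q * a ^ 2 - 1) + c ^ q * c ^ 2 * (a ^ 2 - a ^ q * a ^ 2) + 1 - a ^ 2
      = (1 - c ^ q) * ((1 - a) * (1 + a))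
        - (a * c ^ q * (1 - c) * (1 + c)) * (a * (1 - a ^ q)) := by ring
  rw [hN]
  have hK : 0 ≤ a * c ^ q * (1 - c) * (1 + c) := by positivity
  rcases le_total q 1 with h | h
  · rw [min_eq_right (by linarith)]
    have b1 : q * (1 - c) ≤ 1 - c ^ q := by
      have := rpow_one_add_le_one_add_mul_self (s := c - 1) (by linarith) hq.le h
      rw [show 1 + (c - 1) = c by ring] at this
      linarith
    have b2 : a * (1 - a ^ q) ≤ q * (1 - a) := by
      have := one_add_mul_self_le_rpow_one_add (s := a - 1) (p := 1 + q) (by linarith)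
        (by linarith)
      rw [show 1 + (a - 1) = a by ring, Real.rpow_add ha0, Real.rpow_one] at this
      linarith
    have t1 := mul_le_mul_of_nonneg_right b1 (by positivity : 0 ≤ (1 - a) * (1 + a))
    have t2 := mul_le_mul_of_nonneg_left b2 hK
    have t3 : 0 ≤ q * ((1 - c) * (1 - a)) * (a * (1 + c) * (1 - c ^ q)) :=
      mul_nonneg (by positivity) (mul_nonneg (by positivity) (by linarith))
    linarith
  · rw [min_eq_left (by linarith)]
    have b1 : c ^ q ≤ c := by
      simpa using Real.rpow_le_rpow_of_exponent_ge hc0 hc1.le h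
    have b2 : 1 - a ^ q ≤ q * (1 - a) := by
      have := one_add_mul_self_le_rpow_one_add (s := a - 1) (by linarith) h
      rw [show 1 + (a - 1) = a by ring] at this
      linarith
    have b3 : q * c ^ q * (1 - c) ≤ c * (1 - c ^ q) := by
      have hi : 0 < c⁻¹ := inv_pos.2 hc0
      have := one_add_mul_self_le_rpow_one_add (s := c⁻¹ - 1) (by linarith) h
      rw [show 1 + (c⁻¹ - 1) = c⁻¹ by ring, Real.inv_rpow hc0.le] at this
      have h2 := mul_le_mul_of_nonneg_left this (mul_pos hc0 hu0).le
      have h3 : c * c ^ q * (c ^ q)⁻¹ = c := by field_simp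
      have h4 : c * c ^ q * (1 + q * (c⁻¹ - 1)) = c * c ^ q + q * c ^ q * (1 - c) := by
        field_simp
      rw [h3, h4] at h2
      linarith
    have hF : a * c ≤ a := by nlinarith
    have f1 : a ^ 2 * c ≤ a * c := by nlinarith [mul_pos ha0 hc0]
    have f2 : a ^ 2 * c * c ≤ a := by nlinarith [mul_pos ha0 hc0]
    have hG : 1 - a * c ≤ 1 + a - a ^ 2 * c * (1 + c) := by linarith
    have t1 := mul_le_mul_of_nonneg_left b2 (mul_nonneg hK ha0.le)
    have t2 := mul_le_mul_of_nonneg_left b3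
      (by positivity : 0 ≤ a ^ 2 * (1 + c) * (1 - a))
    have t3 := mul_le_mul (by linarith : 1 - c ≤ 1 - c ^ q) hG hAC.le (by linarith)
    have t4 := mul_le_mul_of_nonneg_right t3 hA.le
    linarith
end
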